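/- arXiv:0906.4942 — 4 statements merged into one kernel-verified Lean document; each statement's English description precedes it below -/
import Mathlib

section
/- Let g ≥ 2 be an integer and let F : ℝ^{n+2} → ℝ be an isoparametric polynomial of degree g, i.e. the evaluation of a homogeneous polynomial of degree g satisfying the Cartan–Münzner equations ‖∇F(x)‖² = g²·‖x‖^{2g−2} and ΔF(x) = c·‖x‖^{g−2} for all x, for some constant c ∈ ℝ. Then the gradient map Φ := (1/g)·∇F satisfies, for every p with ‖p‖ = 1: F(Φ(p)) = cos((g−1)·arccos(F(p))). Equivalently, writing F(p) = cos(g·τ) with τ ∈ [0, π/g], one has F(Φ(p)) = cos(g·(1−g)·τ), i.e. Φ maps the level set M_{cos(gτ)} of F|_{S^{n+1}} into the level set M_{cos(g(1−g)τ)}. -/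
open Real

/-- The Euclidean Laplacian of a function on a finite-dimensional real inner product space,
computed as the sum of second derivatives along an orthonormal basis. -/
noncomputable def laplacian {E : Type*} [NormedAddCommGroup E] [InnerProductSpace ℝ E]
    [FiniteDimensional ℝ E] (f : E → ℝ) (x : E) : ℝ :=
  ∑ i, iteratedFDeriv ℝ 2 f x ![stdOrthonormalBasis ℝ E i, stdOrthonormalBasis ℝ E i]

open scoped Topology Gradient RealInnerProductSpace ContDiff

section Gradient

variable {E : Type*} [NormedAddCommGroup E] [InnerProductSpace ℝ E] [CompleteSpace E]
  {F : E → ℝ}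

theorem ContDiff.gradient {m n : WithTop ℕ∞} (hF : ContDiff ℝ n F) (hmn : m + 1 ≤ n) :
    ContDiff ℝ m (∇ F) :=
  (InnerProductSpace.toDual ℝ E).symm.contDiff.comp (hF.fderiv_right hmn)

theorem inner_fderiv_gradient_left (hF : ContDiff ℝ 2 F) (x v w : E) :
    ⟪fderiv ℝ (∇ F) x v, w⟫ = fderiv ℝ (fderiv ℝ F) x v w := by
  have hG : HasFDerivAt (∇ F) (fderiv ℝ (∇ F) x) x :=
    ((hF.gradient (m := 1) (by norm_num)).differentiable (by norm_num) x).hasFDerivAt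
  have hD : HasFDerivAt (fderiv ℝ F) (fderiv ℝ (fderiv ℝ F) x) x :=
    ((hF.fderiv_right (m := 1) (by norm_num)).differentiable (by norm_num) x).hasFDerivAt
  have h1 := hG.inner ℝ (hasFDerivAt_const w x)
  have h2 := hD.clm_apply (hasFDerivAt_const w x)
  have he : (fun y => ⟪∇ F y, w⟫) = fun y => fderiv ℝ F y w := by
    funext y
    exact inner_gradient_left
  rw [he] at h1
  simpa using DFunLike.congr_fun (h1.unique h2) v

/-- The Hessian, as the derivative of the gradient, is a symmetric operator. -/
theorem inner_fderiv_gradient_comm (hF : ContDiff ℝ 2 F) (x v w : E) :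
    ⟪fderiv ℝ (∇ F) x v, w⟫ = ⟪fderiv ℝ (∇ F) x w, v⟫ := by
  rw [inner_fderiv_gradient_left hF, inner_fderiv_gradient_left hF]
  exact (hF.contDiffAt.isSymmSndFDerivAt (by simp)) v w

/-- Euler's identity for homogeneous functions. -/
theorem inner_gradient_self_of_homogeneous {g : ℕ} (hF : Differentiable ℝ F)
    (hom : ∀ (t : ℝ) x, F (t • x) = t ^ g * F x) (x : E) :
    ⟪∇ F x, x⟫ = g * F x := by
  have h1 : HasDerivAt (fun t : ℝ => F (t • x)) (fderiv ℝ F x x) 1 := by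
    have h : HasDerivAt (fun t : ℝ => t • x) x 1 := by
      simpa using (hasDerivAt_id (1 : ℝ)).smul_const x
    refine HasFDerivAt.comp_hasDerivAt (1 : ℝ) ?_ h
    simpa using (hF x).hasFDerivAt
  have h2 : HasDerivAt (fun t : ℝ => t ^ g * F x) (g * F x) 1 := by
    simpa using (hasDerivAt_pow g (1 : ℝ)).mul_const (F x)
  rw [inner_gradient_left]
  simp_rw [hom] at h1
  exact h1.unique h2

theorem fderiv_gradient_self_of_homogeneous {g : ℕ} (hF : ContDiff ℝ 2 F)
    (hom : ∀ (t : ℝ) x, F (t • x) = t ^ g * F x) (x : E) :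
    fderiv ℝ (∇ F) x x = ((g : ℝ) - 1) • ∇ F x := by
  refine ext_inner_right ℝ fun v => ?_
  have hd : Differentiable ℝ F := hF.differentiable (by norm_num)
  have hG : HasFDerivAt (∇ F) (fderiv ℝ (∇ F) x) x :=
    ((hF.gradient (m := 1) (by norm_num)).differentiable (by norm_num) x).hasFDerivAt
  have h1 := hG.inner ℝ (hasFDerivAt_id x)
  have h2 := (hd x).hasFDerivAt.const_mul (g : ℝ)
  have he : (fun y => ⟪∇ F y, id y⟫) = fun y => g * F y := by
    funext y
    exact inner_gradient_self_of_homogeneous hd hom y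
  rw [he] at h1
  have h3 := DFunLike.congr_fun (h1.unique h2) v
  simp only [ContinuousLinearMap.comp_apply, ContinuousLinearMap.prod_apply,
    fderivInnerCLM_apply, ContinuousLinearMap.id_apply, id_eq, smul_apply,
    smul_eq_mul, ← inner_gradient_left] at h3
  rw [inner_fderiv_gradient_comm hF, inner_smul_left]
  simp only [conj_trivial]
  linarith

/-- Differentiating the eikonal equation `‖∇F‖² = g² ‖x‖^{2g-2}` on the unit sphere. -/
theorem fderiv_gradient_gradient_of_eikonal {g : ℕ} (hg : 1 ≤ g) (hF : ContDiff ℝ 2 F)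
    (heik : ∀ x, ‖∇ F x‖ ^ 2 = (g : ℝ) ^ 2 * ‖x‖ ^ (2 * g - 2)) {x : E} (hx : ‖x‖ = 1) :
    fderiv ℝ (∇ F) x (∇ F x) = ((g : ℝ) ^ 2 * (g - 1)) • x := by
  refine ext_inner_right ℝ fun v => ?_
  have hG : HasFDerivAt (∇ F) (fderiv ℝ (∇ F) x) x :=
    ((hF.gradient (m := 1) (by norm_num)).differentiable (by norm_num) x).hasFDerivAt
  have h1 := hG.norm_sq
  have h2 := (((hasFDerivAt_id x).norm_sq).pow (g - 1)).const_mul ((g : ℝ) ^ 2)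
  have he : (fun y => ‖∇ F y‖ ^ 2) = fun y => (g : ℝ) ^ 2 * (‖id y‖ ^ 2) ^ (g - 1) := by
    funext y
    rw [heik, ← pow_mul, id, Nat.mul_sub, mul_one]
  rw [he] at h1
  have h3 := DFunLike.congr_fun (h1.unique h2) v
  simp [hx, Nat.cast_sub hg, -inner_gradient_left] at h3
  rw [inner_fderiv_gradient_comm hF, inner_smul_left, real_inner_comm]
  simp only [conj_trivial]
  linarith

end Gradient

section Circle

variable {E : Type*} [NormedAddCommGroup E] [InnerProductSpace ℝ E]

theorem norm_cos_smul_add_sin_smul {p ν : E} (hp : ‖p‖ = 1) (hν : ‖ν‖ = 1) (hpν : ⟪p, ν⟫ = 0)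
    (t : ℝ) : ‖cos t • p + sin t • ν‖ = 1 := by
  rw [← sq_eq_sq₀ (norm_nonneg _) zero_le_one, norm_add_sq_real]
  simp [norm_smul, inner_smul_left, inner_smul_right, hp, hν, hpν]

variable [CompleteSpace E] {F : E → ℝ} {g : ℕ}

/-- Starting at a regular point `p` of the sphere in the direction `ν` of the tangential gradient,
the great circle through `p` is an integral curve of the normalized tangential gradient, and `F`
restricts to a cosine on it. -/
theorem apply_cos_smul_add_sin_smul_of_eikonal (hg : 1 ≤ g) (hF : ContDiff ℝ ω F)
    (hom : ∀ (t : ℝ) x, F (t • x) = t ^ g * F x)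
    (heik : ∀ x, ‖∇ F x‖ ^ 2 = (g : ℝ) ^ 2 * ‖x‖ ^ (2 * g - 2))
    {p ν : E} (hp : ‖p‖ = 1) (hν : ‖ν‖ = 1) (hpν : ⟪p, ν⟫ = 0) {α : ℝ} (hα : sin α ≠ 0)
    (hpG : ∇ F p = (g : ℝ) • (cos α • p + sin α • ν)) (t : ℝ) :
    F (cos t • p + sin t • ν) = cos (α - g * t) := by
  have hF2 : ContDiff ℝ 2 F := hF.of_le le_top
  have hg0 : (g : ℝ) ≠ 0 := by positivity
  set γ : ℝ → E := fun t => cos t • p + sin t • ν with hγ_def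
  set γ' : ℝ → E := fun t => -sin t • p + cos t • ν with hγ'_def
  set β : ℝ → ℝ := fun t => α - g * t with hβ_def
  have hγ (t : ℝ) : HasDerivAt γ (γ' t) t :=
    ((hasDerivAt_cos t).smul_const p).add ((hasDerivAt_sin t).smul_const ν)
  have hγ' (t : ℝ) : HasDerivAt γ' (-γ t) t := by
    refine (((hasDerivAt_sin t).neg.smul_const p).add
      ((hasDerivAt_cos t).smul_const ν)).congr_deriv ?_
    change _ = -(cos t • p + sin t • ν)
    module
  have hβ (t : ℝ) : HasDerivAt β (-g) t := by
    simpa using ((hasDerivAt_id t).const_mul (g : ℝ)).const_sub α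
  have hG : ContDiff ℝ 1 (∇ F) := hF2.gradient (by norm_num)
  set H : ℝ → E →L[ℝ] E := fun t => fderiv ℝ (∇ F) (γ t) with hH_def
  have hγc : Continuous γ := continuous_iff_continuousAt.2 fun t => (hγ t).continuousAt
  have hβc : Continuous β := continuous_iff_continuousAt.2 fun t => (hβ t).continuousAt
  have hHc : Continuous H := (hG.continuous_fderiv (by norm_num)).comp hγc
  set V : ℝ → E := fun t => ∇ F (γ t) - (g : ℝ) • (cos (β t) • γ t + sin (β t) • γ' t) with hV_def
  have hV (t : ℝ) : HasDerivAt V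
      (H t (γ' t) - ((g : ℝ) * (g - 1)) • (sin (β t) • γ t - cos (β t) • γ' t)) t := by
    have h1 := HasFDerivAt.comp_hasDerivAt t
      ((hG.differentiable (by norm_num) (γ t)).hasFDerivAt) (hγ t)
    have h2 := ((hβ t).cos.smul (hγ t)).add ((hβ t).sin.smul (hγ' t))
    refine (h1.sub (h2.const_smul (g : ℝ))).congr_deriv ?_
    change H t (γ' t) - _ = H t (γ' t) - _
    generalize γ t = x, γ' t = y
    module
  have hVlin (t : ℝ) (ht : sin (β t) ≠ 0) :
      H t (γ' t) - ((g : ℝ) * (g - 1)) • (sin (β t) • γ t - cos (β t) • γ' t) =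
        (-(sin (β t))⁻¹) • (((g : ℝ) - 1) * cos (β t)) • V t +
          (-(sin (β t))⁻¹ * (g : ℝ)⁻¹) • H t (V t) := by
    have h1 : H t (∇ F (γ t)) = ((g : ℝ) ^ 2 * (g - 1)) • γ t :=
      fderiv_gradient_gradient_of_eikonal hg hF2 heik
        (norm_cos_smul_add_sin_smul hp hν hpν t)
    have h2 : H t (γ t) = ((g : ℝ) - 1) • ∇ F (γ t) :=
      fderiv_gradient_self_of_homogeneous hF2 hom (γ t)
    have h3 : H t (V t) = ((g : ℝ) ^ 2 * (g - 1)) • γ t - (g : ℝ) •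
        (cos (β t) • ((g : ℝ) - 1) • ∇ F (γ t) + sin (β t) • H t (γ' t)) := by
      simp only [hV_def, map_sub, map_add, map_smul, h1, h2]
    rw [h3]
    simp only [hV_def]
    have hsc := sin_sq_add_cos_sq (β t)
    generalize H t (γ' t) = w, ∇ F (γ t) = u, γ t = x, γ' t = y
    match_scalars
    · field_simp
    · field_simp
      linear_combination (1 - (g : ℝ)) * hsc
    · field_simp
    · field_simp
      ring
  have hV0 : V 0 = 0 := by
    simp [hV_def, hγ_def, hγ'_def, hβ_def, hpG]
  set k : ℝ → ℝ := fun t => ‖-(sin (β t))⁻¹‖ * ‖((g : ℝ) - 1) * cos (β t)‖ +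
    ‖-(sin (β t))⁻¹ * (g : ℝ)⁻¹‖ * ‖H t‖ with hk_def
  have hβ0 : sin (β 0) ≠ 0 := by simpa [hβ_def] using hα
  have hsc : Continuous fun t => sin (β t) := continuous_sin.comp hβc
  have hcc : Continuous fun t => cos (β t) := continuous_cos.comp hβc
  have hkc : ContinuousAt k 0 := by
    have hi : ContinuousAt (fun t => -(sin (β t))⁻¹) 0 := (hsc.continuousAt.inv₀ hβ0).neg
    exact (hi.norm.mul (continuousAt_const.mul hcc.continuousAt).norm).add
      ((hi.mul continuousAt_const).norm.mul hHc.continuousAt.norm)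
  have hev : ∀ᶠ t in 𝓝 (0 : ℝ), sin (β t) ≠ 0 ∧ k t < k 0 + 1 :=
    (hsc.continuousAt.eventually_ne hβ0).and (hkc.eventually_lt_const (by linarith))
  obtain ⟨ε, hε, hball⟩ := Metric.eventually_nhds_iff.1 hev
  have hVz : ∀ t ∈ Set.Icc 0 (ε / 2), V t = 0 := by
    refine eq_zero_of_abs_deriv_le_mul_abs_self_of_eq_zero_right (K := k 0 + 1)
      (fun t _ => (hV t).continuousAt.continuousWithinAt)
      (fun t _ => (hV t).hasDerivWithinAt) hV0 fun t ht => ?_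
    obtain ⟨hs, hk⟩ := @hball t (by
      rw [Real.dist_eq, sub_zero, abs_of_nonneg ht.1]
      linarith [ht.2])
    rw [hVlin t hs]
    calc _ ≤ k t * ‖V t‖ := by
          refine (norm_add_le _ _).trans ?_
          rw [norm_smul, norm_smul, norm_smul, hk_def, add_mul, mul_assoc, mul_assoc]
          gcongr
          exact (H t).le_opNorm _
      _ ≤ _ := by gcongr
  have hFγ : ∀ t ∈ Set.Icc 0 (ε / 2), F (γ t) = cos (β t) := by
    intro t ht
    have h1 := inner_gradient_self_of_homogeneous (hF2.differentiable (by norm_num)) hom (γ t)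
    rw [sub_eq_zero.1 (hVz t ht)] at h1
    have h2 : ⟪γ t, γ t⟫ = 1 := by
      rw [real_inner_self_eq_norm_sq, norm_cos_smul_add_sin_smul hp hν hpν t, one_pow]
    have h3 : ⟪γ' t, γ t⟫ = 0 := by
      simp only [hγ_def, hγ'_def, inner_add_left, inner_add_right, inner_smul_left,
        inner_smul_right, real_inner_self_eq_norm_sq, hp, hν, real_inner_comm p ν, hpν,
        conj_trivial]
      ring
    rw [inner_smul_left, inner_add_left, inner_smul_left, inner_smul_left, h2, h3] at h1
    simpa [hg0] using h1.symm
  have hγa : ContDiff ℝ ω γ :=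
    (contDiff_cos.smul contDiff_const).add (contDiff_sin.smul contDiff_const)
  have hβa : ContDiff ℝ ω β := contDiff_const.sub (contDiff_const.mul contDiff_id)
  have han1 : AnalyticOnNhd ℝ (fun t => F (γ t)) Set.univ :=
    fun t _ => (hF.comp hγa).contDiffAt.analyticAt
  have han2 : AnalyticOnNhd ℝ (fun t => cos (β t)) Set.univ :=
    fun t _ => (contDiff_cos.comp hβa).contDiffAt.analyticAt
  refine congrFun (han1.eq_of_frequently_eq (z₀ := 0) han2 ?_) t
  refine Filter.Frequently.filter_mono (Filter.Eventually.frequently (f := 𝓝[>] (0 : ℝ)) ?_)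
    (nhdsWithin_mono _ fun t ht => ne_of_gt ht)
  filter_upwards [Ioo_mem_nhdsGT (half_pos hε)] with t ht
  exact hFγ t (Set.Ioo_subset_Icc_self ht)

theorem apply_gradient_of_eikonal (hg : 1 ≤ g) (hF : ContDiff ℝ ω F)
    (hom : ∀ (t : ℝ) x, F (t • x) = t ^ g * F x)
    (heik : ∀ x, ‖∇ F x‖ ^ 2 = (g : ℝ) ^ 2 * ‖x‖ ^ (2 * g - 2)) {p : E} (hp : ‖p‖ = 1) :
    F ((g : ℝ)⁻¹ • ∇ F p) = cos (((g : ℝ) - 1) * arccos (F p)) := by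
  have hg0 : (g : ℝ) ≠ 0 := by positivity
  set q : E := (g : ℝ)⁻¹ • ∇ F p with hq_def
  have hqG : ∇ F p = (g : ℝ) • q := by rw [hq_def, smul_inv_smul₀ hg0]
  clear_value q
  have hqn : ‖q‖ = 1 := by
    have h := heik p
    rw [hp, one_pow, mul_one, hqG, norm_smul, mul_pow, Real.norm_eq_abs, sq_abs] at h
    have h1 : ‖q‖ ^ 2 = 1 := by simpa [hg0] using h
    exact (pow_eq_one_iff_of_nonneg (norm_nonneg q) two_ne_zero).1 h1
  have hqp : ⟪q, p⟫ = F p := by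
    have h := inner_gradient_self_of_homogeneous (hF.differentiable (by simp)) hom p
    rw [hqG, inner_smul_left] at h
    simpa [hg0] using h
  have habs : |F p| ≤ 1 := by
    simpa [hqp, hqn, hp] using abs_real_inner_le_norm q p
  obtain ⟨hlo, hhi⟩ := abs_le.1 habs
  set α := arccos (F p)
  have hcos : cos α = F p := cos_arccos hlo hhi
  have hnorm : ‖q - cos α • p‖ ^ 2 = sin α ^ 2 := by
    rw [norm_sub_sq_real, norm_smul, inner_smul_right, hqp, hqn, hp, Real.norm_eq_abs, mul_one,
      sq_abs, ← hcos]
    linarith [sin_sq_add_cos_sq α]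
  by_cases hs : sin α = 0
  · have hq : q = cos α • p := by
      rw [hs] at hnorm
      exact sub_eq_zero.1 (norm_eq_zero.1 (by simpa using hnorm))
    have hexp : cos (((g : ℝ) - 1) * α) = cos (g * α) * cos α := by
      rw [sub_mul, one_mul, cos_sub, hs, mul_zero, add_zero]
    have hpow : ∀ j : ℕ, cos (j * α) = cos α ^ j := by
      intro j
      induction j with
      | zero => simp
      | succ j ih =>
        rw [Nat.cast_succ, add_mul, one_mul, cos_add, hs, mul_zero, sub_zero, ih, pow_succ]
    rw [hexp, hq, hom, hpow, hcos]
  · set ν : E := (sin α)⁻¹ • (q - cos α • p) with hν_def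
    have hqν : q = cos α • p + sin α • ν := by
      rw [hν_def, smul_inv_smul₀ hs]
      abel
    have hν : ‖ν‖ = 1 := by
      rw [← sq_eq_sq₀ (norm_nonneg _) zero_le_one, hν_def, norm_smul, mul_pow, hnorm, norm_inv,
        Real.norm_eq_abs, inv_pow, sq_abs]
      field_simp
    have hpν : ⟪p, ν⟫ = 0 := by
      rw [hν_def, inner_smul_right, inner_sub_right, inner_smul_right, real_inner_comm, hqp,
        real_inner_self_eq_norm_sq, hp, hcos]
      ring
    rw [hqν, apply_cos_smul_add_sin_smul_of_eikonal hg hF hom heik hp hν hpν hs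
      (by rw [← hqν, hqG]), ← cos_neg]
    ring_nf

end Circle

theorem MvPolynomial.IsHomogeneous.eval_smul {σ R : Type*} [CommSemiring R]
    {P : MvPolynomial σ R} {g : ℕ} (hP : P.IsHomogeneous g) (t : R) (x : σ → R) :
    MvPolynomial.eval (t • x) P = t ^ g * MvPolynomial.eval x P := by
  rw [MvPolynomial.eval_eq, MvPolynomial.eval_eq, Finset.mul_sum]
  refine Finset.sum_congr rfl fun d hd => ?_
  have hdeg : ∑ i ∈ d.support, d i = g := by
    have h := hP (MvPolynomial.mem_support_iff.1 hd)
    rwa [Finsupp.weight_apply, Finsupp.sum, Finset.sum_congr rfl fun i _ => by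
      rw [Pi.one_apply, smul_eq_mul, mul_one]] at h
  simp only [Pi.smul_apply, smul_eq_mul, mul_pow, Finset.prod_mul_distrib,
    Finset.prod_pow_eq_pow_sum, hdeg]
  ring

/-- Let `F` be an isoparametric polynomial of degree `g ≥ 2`, i.e. the
evaluation of a homogeneous polynomial of degree `g` satisfying the Cartan–Münzner equations
`‖∇F(x)‖² = g² ‖x‖^{2g-2}` and `ΔF(x) = c ‖x‖^{g-2}`.  Then the gradient map `Φ = (1/g) ∇F`
satisfies `F(Φ(p)) = cos((g-1) arccos(F(p)))` for every `p` on the unit sphere; equivalently,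
writing `F(p) = cos(g τ)` with `τ ∈ [0, π/g]`, one has `F(Φ(p)) = cos(g (1-g) τ)`, i.e. `Φ`
maps the level set `M_{cos(gτ)}` of `F|_{S^{n+1}}` into the level set `M_{cos(g(1-g)τ)}`. -/
theorem gradientMap_level_of_isoparametric (n g : ℕ) (hg : 2 ≤ g)
    (F : EuclideanSpace ℝ (Fin (n + 2)) → ℝ)
    (P : MvPolynomial (Fin (n + 2)) ℝ) (hP : P.IsHomogeneous g)
    (hFP : ∀ x, F x = MvPolynomial.eval x P)
    (hCM1 : ∀ x, ‖gradient F x‖ ^ 2 = (g : ℝ) ^ 2 * ‖x‖ ^ (2 * g - 2))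
    (c : ℝ) (hCM2 : ∀ x, laplacian F x = c * ‖x‖ ^ (g - 2))
    (Φ : EuclideanSpace ℝ (Fin (n + 2)) → EuclideanSpace ℝ (Fin (n + 2)))
    (hΦ : ∀ x, Φ x = (g : ℝ)⁻¹ • gradient F x) :
    ∀ p : EuclideanSpace ℝ (Fin (n + 2)), ‖p‖ = 1 →
      F (Φ p) = Real.cos (((g : ℝ) - 1) * Real.arccos (F p)) ∧
      ∀ τ : ℝ, τ ∈ Set.Icc 0 (π / g) → F p = Real.cos (g * τ) →
        F (Φ p) = Real.cos ((g : ℝ) * (1 - (g : ℝ)) * τ) := by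
  have hF : ContDiff ℝ ω F := by
    have h : AnalyticOnNhd ℝ F Set.univ := by
      have he : F = fun x => MvPolynomial.aeval x.ofLp P := by
        funext x
        rw [hFP, MvPolynomial.aeval_eq_eval]
      rw [he]
      refine AnalyticOnNhd.aeval_mvPolynomial (fun i => ?_) P
      exact ContinuousLinearMap.analyticOnNhd
        (EuclideanSpace.proj i : EuclideanSpace ℝ (Fin (n + 2)) →L[ℝ] ℝ) Set.univ
    exact contDiff_iff_contDiffAt.2 fun x => (h x trivial).contDiffAt
  have hom (t : ℝ) (x : EuclideanSpace ℝ (Fin (n + 2))) : F (t • x) = t ^ g * F x := by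
    rw [hFP, hFP, WithLp.ofLp_smul, hP.eval_smul]
  intro p hp
  have hmain : F (Φ p) = cos (((g : ℝ) - 1) * arccos (F p)) := by
    rw [hΦ]
    exact apply_gradient_of_eikonal (by omega) hF hom hCM1 hp
  refine ⟨hmain, fun τ hτ hFτ => ?_⟩
  have hg0 : (0 : ℝ) < g := by positivity
  have hle : (g : ℝ) * τ ≤ π := by
    rw [mul_comm]
    exact (le_div_iff₀ hg0).1 hτ.2
  rw [hmain, hFτ, arccos_cos (mul_nonneg hg0.le hτ.1) hle, ← cos_neg]
  ring_nf
end

section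
/- Let g ≥ 1 be an integer and let F : ℝ^{n+2} → ℝ be the evaluation of a homogeneous polynomial of degree g satisfying ‖∇F(x)‖² = g²·‖x‖^{2g−2} for all x. If ‖p‖ = 1 and F(p) = −1, then Φ(p) = −p, where Φ := (1/g)·∇F. That is, Φ restricted to the focal submanifold M_{−1} = { p ∈ S^{n+1} : F(p) = −1 } is the antipodal map. -/
theorem MvPolynomial.differentiable_eval_euclidean {ι : Type*} [Fintype ι]
    (P : MvPolynomial ι ℝ) :
    Differentiable ℝ fun x : EuclideanSpace ℝ ι => MvPolynomial.eval x P := by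
  induction P using MvPolynomial.induction_on with
  | C a => simp
  | add p q hp hq => simpa using hp.fun_add hq
  | mul_X p i hp =>
    simp only [map_mul, MvPolynomial.eval_X]
    exact hp.fun_mul (by fun_prop)

/-- Euler's identity for the gradient of a function homogeneous along the ray through `p`. -/
theorem inner_gradient_self_of_homogeneous_s7 {E : Type*} [NormedAddCommGroup E]
    [InnerProductSpace ℝ E] [CompleteSpace E] {F : E → ℝ} {p : E} {g : ℕ}
    (hF : DifferentiableAt ℝ F p) (hom : ∀ t : ℝ, F (t • p) = t ^ g * F p) :
    inner ℝ (gradient F p) p = g * F p := by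
  have hline : HasDerivAt (fun t : ℝ => t • p) p 1 := by
    simpa using (hasDerivAt_id (1 : ℝ)).smul_const p
  have hcomp : HasDerivAt (fun t : ℝ => F (t • p)) (fderiv ℝ F p p) 1 := by
    have hp : HasFDerivAt F (fderiv ℝ F p) ((1 : ℝ) • p) := by simpa using hF.hasFDerivAt
    exact hp.comp_hasDerivAt 1 hline
  have hpow : HasDerivAt (fun t : ℝ => F (t • p)) (g * F p) 1 := by
    simp only [hom]
    simpa using (hasDerivAt_pow g (1 : ℝ)).mul_const (F p)
  rw [gradient, InnerProductSpace.toDual_symm_apply]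
  exact hcomp.unique hpow

theorem MvPolynomial.IsHomogeneous.eval_smul_point {ι R : Type*} [CommSemiring R]
    {P : MvPolynomial ι R} {g : ℕ} (hP : P.IsHomogeneous g) (t : R) (x : ι → R) :
    MvPolynomial.eval (t • x) P = t ^ g * MvPolynomial.eval x P := by
  rw [MvPolynomial.eval_eq, MvPolynomial.eval_eq, Finset.mul_sum]
  refine Finset.sum_congr rfl fun d hd => ?_
  have hdeg : ∑ i ∈ d.support, d i = g := by
    rw [← hP (MvPolynomial.mem_support_iff.mp hd), Finsupp.weight_apply, Finsupp.sum]
    simp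
  simp only [Pi.smul_apply, smul_eq_mul, mul_pow, Finset.prod_mul_distrib,
    Finset.prod_pow_eq_pow_sum, hdeg]
  ring

/-- For `F` the evaluation of a homogeneous polynomial of degree `g ≥ 1`
satisfying `‖∇F(x)‖² = g² ‖x‖^{2g-2}`: if `‖p‖ = 1` and `F(p) = -1` then `Φ(p) = -p` for the
gradient map `Φ = (1/g) ∇F`; i.e. `Φ` restricted to the focal submanifold
`M₋₁ = {p ∈ S^{n+1} : F(p) = -1}` is the antipodal map. -/
theorem gradientMap_antipodal_on_focal_Mneg1 (n g : ℕ) (hg : 1 ≤ g)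
    (F : EuclideanSpace ℝ (Fin (n + 2)) → ℝ)
    (P : MvPolynomial (Fin (n + 2)) ℝ) (hP : P.IsHomogeneous g)
    (hFP : ∀ x, F x = MvPolynomial.eval x P)
    (hCM1 : ∀ x, ‖gradient F x‖ ^ 2 = (g : ℝ) ^ 2 * ‖x‖ ^ (2 * g - 2))
    (Φ : EuclideanSpace ℝ (Fin (n + 2)) → EuclideanSpace ℝ (Fin (n + 2)))
    (hΦ : ∀ x, Φ x = (g : ℝ)⁻¹ • gradient F x) :
    ∀ p : EuclideanSpace ℝ (Fin (n + 2)), ‖p‖ = 1 → F p = -1 → Φ p = -p := by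
  intro p hp hFp
  have hg0 : (g : ℝ) ≠ 0 := by positivity
  have hFeq : F = fun x : EuclideanSpace ℝ (Fin (n + 2)) => MvPolynomial.eval x P := funext hFP
  have hdiff : DifferentiableAt ℝ F p := by
    rw [hFeq]
    exact P.differentiable_eval_euclidean p
  have hom (t : ℝ) : F (t • p) = t ^ g * F p := by
    rw [hFP, hFP]
    exact hP.eval_smul_point t p
  have hinner : inner ℝ (Φ p) p = -1 := by
    rw [hΦ, real_inner_smul_left, inner_gradient_self_of_homogeneous_s7 hdiff hom, hFp]
    field_simp
  have hnorm : ‖Φ p‖ ^ 2 = 1 := by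
    rw [hΦ, norm_smul, mul_pow, hCM1, hp]
    simp [hg0]
  have hzero : ‖Φ p + p‖ ^ 2 = 0 := by
    rw [norm_add_sq_real, hinner, hnorm, hp]
    norm_num
  exact eq_neg_of_add_eq_zero_left (norm_eq_zero.mp (pow_eq_zero_iff two_ne_zero |>.mp hzero))
end

section
/- Define F : ℝ³ × ℝ³ → ℝ by F(x, y) = (‖x‖² + ‖y‖²)² − 2·((‖x‖² − ‖y‖²)² + 4·⟨x, y⟩²). Then F is a homogeneous polynomial of degree 4 satisfying the Cartan–Münzner equations with g = 4 and m₁ = m₂ = 1: ‖∇F(x, y)‖² = 16·(‖x‖² + ‖y‖²)³ for all (x, y), and ΔF = 0 identically (F is a harmonic polynomial). -/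
/-- Identifying `ℝ³ × ℝ³ ≅ ℝ⁶` via `p = (x, y)` with `x = (p 0, p 1, p 2)` and
`y = (p 3, p 4, p 5)`: the squared norm `‖x‖²`. -/
def normSqX (p : EuclideanSpace ℝ (Fin 6)) : ℝ := p 0 ^ 2 + p 1 ^ 2 + p 2 ^ 2

/-- The squared norm `‖y‖²` of the second `ℝ³`-factor. -/
def normSqY (p : EuclideanSpace ℝ (Fin 6)) : ℝ := p 3 ^ 2 + p 4 ^ 2 + p 5 ^ 2

/-- The Euclidean inner product `⟨x, y⟩` of the two `ℝ³`-factors. -/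
def innXY (p : EuclideanSpace ℝ (Fin 6)) : ℝ := p 0 * p 3 + p 1 * p 4 + p 2 * p 5

/-- The Cartan–Münzner polynomial
`F(x, y) = (‖x‖² + ‖y‖²)² - 2((‖x‖² - ‖y‖²)² + 4⟨x, y⟩²)` on `ℝ³ × ℝ³ ≅ ℝ⁶`. -/
def isoparamF (p : EuclideanSpace ℝ (Fin 6)) : ℝ :=
  (normSqX p + normSqY p) ^ 2 - 2 * ((normSqX p - normSqY p) ^ 2 + 4 * innXY p ^ 2)

/-- The Fréchet derivative of a polynomial function on Euclidean space is given by its formal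
partial derivatives. -/
theorem MvPolynomial.hasFDerivAt_eval_euclidean {n : ℕ} (P : MvPolynomial (Fin n) ℝ)
    (p : EuclideanSpace ℝ (Fin n)) :
    HasFDerivAt (fun q : EuclideanSpace ℝ (Fin n) => MvPolynomial.eval q P)
      (∑ i, MvPolynomial.eval p (MvPolynomial.pderiv i P) •
        (EuclideanSpace.proj i : EuclideanSpace ℝ (Fin n) →L[ℝ] ℝ)) p := by
  induction P using MvPolynomial.induction_on with
  | C a => simpa using hasFDerivAt_const a p
  | add P Q hP hQ =>
    simpa only [map_add, add_smul, Finset.sum_add_distrib] using hP.fun_add hQ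
  | mul_X P j hP =>
    have hX : HasFDerivAt (fun q : EuclideanSpace ℝ (Fin n) => q j)
        (EuclideanSpace.proj j : EuclideanSpace ℝ (Fin n) →L[ℝ] ℝ) p :=
      (EuclideanSpace.proj j : EuclideanSpace ℝ (Fin n) →L[ℝ] ℝ).hasFDerivAt
    have h := hP.fun_mul hX
    simp only [map_mul, MvPolynomial.eval_X]
    refine h.congr_fderiv ?_
    ext v
    simp [MvPolynomial.pderiv_X, Pi.single_apply, add_mul, Finset.sum_add_distrib,
      Finset.mul_sum, apply_ite (MvPolynomial.eval p.ofLp), mul_assoc]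

theorem MvPolynomial.fderiv_eval_euclidean_single {n : ℕ} (P : MvPolynomial (Fin n) ℝ)
    (p : EuclideanSpace ℝ (Fin n)) (i : Fin n) :
    fderiv ℝ (fun q : EuclideanSpace ℝ (Fin n) => MvPolynomial.eval q P) p
      (EuclideanSpace.single i 1) = MvPolynomial.eval p (MvPolynomial.pderiv i P) := by
  rw [(P.hasFDerivAt_eval_euclidean p).fderiv]
  simp [PiLp.single_apply]

theorem MvPolynomial.norm_gradient_eval_sq {n : ℕ} (P : MvPolynomial (Fin n) ℝ)
    (p : EuclideanSpace ℝ (Fin n)) :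
    ‖gradient (fun q : EuclideanSpace ℝ (Fin n) => MvPolynomial.eval q P) p‖ ^ 2 =
      ∑ i, MvPolynomial.eval p (MvPolynomial.pderiv i P) ^ 2 := by
  rw [EuclideanSpace.real_norm_sq_eq]
  refine Finset.sum_congr rfl fun i _ => ?_
  have h := InnerProductSpace.toDual_symm_apply (𝕜 := ℝ) (x := EuclideanSpace.single i (1 : ℝ))
    (y := fderiv ℝ (fun q : EuclideanSpace ℝ (Fin n) => MvPolynomial.eval q P) p)
  rw [P.fderiv_eval_euclidean_single p i, EuclideanSpace.inner_single_right, one_mul] at h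
  exact congrArg (· ^ 2) h

theorem MvPolynomial.differentiable_fderiv_eval_euclidean {n : ℕ} (P : MvPolynomial (Fin n) ℝ) :
    Differentiable ℝ
      (fderiv ℝ (fun q : EuclideanSpace ℝ (Fin n) => MvPolynomial.eval q P)) := by
  rw [_root_.funext fun p => (P.hasFDerivAt_eval_euclidean p).fderiv]
  exact Differentiable.fun_sum fun i _ => Differentiable.smul_const
    (fun p => ((MvPolynomial.pderiv i P).hasFDerivAt_eval_euclidean p).differentiableAt) _

theorem MvPolynomial.laplacian_eval {n : ℕ} (P : MvPolynomial (Fin n) ℝ)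
    (p : EuclideanSpace ℝ (Fin n)) :
    laplacian (fun q : EuclideanSpace ℝ (Fin n) => MvPolynomial.eval q P) p =
      ∑ i, MvPolynomial.eval p (MvPolynomial.pderiv i (MvPolynomial.pderiv i P)) := by
  have hstd := congrFun (InnerProductSpace.laplacian_eq_iteratedFDeriv_stdOrthonormalBasis
    (fun q : EuclideanSpace ℝ (Fin n) => MvPolynomial.eval q P)) p
  have hbasis := congrFun (InnerProductSpace.laplacian_eq_iteratedFDeriv_orthonormalBasis
    (fun q : EuclideanSpace ℝ (Fin n) => MvPolynomial.eval q P)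
    (EuclideanSpace.basisFun (Fin n) ℝ)) p
  refine (hstd.symm.trans hbasis).trans (Finset.sum_congr rfl fun i _ => ?_)
  rw [iteratedFDeriv_two_apply, ← MvPolynomial.fderiv_eval_euclidean_single]
  simp only [← P.fderiv_eval_euclidean_single]
  rw [fderiv_clm_apply (P.differentiable_fderiv_eval_euclidean p) (differentiableAt_const _)]
  simp

open MvPolynomial in
/-- The polynomial in six variables whose evaluation is `isoparamF`. -/
noncomputable def isoparamPolynomial : MvPolynomial (Fin 6) ℝ :=
  ((X 0 ^ 2 + X 1 ^ 2 + X 2 ^ 2) + (X 3 ^ 2 + X 4 ^ 2 + X 5 ^ 2)) ^ 2 -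
    C 2 * (((X 0 ^ 2 + X 1 ^ 2 + X 2 ^ 2) - (X 3 ^ 2 + X 4 ^ 2 + X 5 ^ 2)) ^ 2 +
      C 4 * (X 0 * X 3 + X 1 * X 4 + X 2 * X 5) ^ 2)

open MvPolynomial in
theorem isoparamPolynomial_isHomogeneous : isoparamPolynomial.IsHomogeneous 4 := by
  have hsq (i : Fin 6) : (X i ^ 2 : MvPolynomial (Fin 6) ℝ).IsHomogeneous 2 :=
    isHomogeneous_X_pow i 2
  have hmul (i j : Fin 6) : (X i * X j : MvPolynomial (Fin 6) ℝ).IsHomogeneous 2 :=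
    (isHomogeneous_X ℝ i).mul (isHomogeneous_X ℝ j)
  have hx := ((hsq 0).add (hsq 1)).add (hsq 2)
  have hy := ((hsq 3).add (hsq 4)).add (hsq 5)
  have hxy := ((hmul 0 3).add (hmul 1 4)).add (hmul 2 5)
  exact ((hx.add hy).pow 2).sub ((((hx.sub hy).pow 2).add ((hxy.pow 2).C_mul 4)).C_mul 2)

theorem isoparamF_eq_eval :
    isoparamF = fun p : EuclideanSpace ℝ (Fin 6) => MvPolynomial.eval p isoparamPolynomial := by
  funext p
  simp [isoparamF, isoparamPolynomial, normSqX, normSqY, innXY]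


/-- The polynomial
`F(x, y) = (‖x‖² + ‖y‖²)² - 2((‖x‖² - ‖y‖²)² + 4⟨x, y⟩²)` on `ℝ³ × ℝ³ ≅ ℝ⁶` is a
homogeneous polynomial of degree `4` satisfying the Cartan–Münzner equations with `g = 4`
and `m₁ = m₂ = 1`: `‖∇F(x, y)‖² = 16 (‖x‖² + ‖y‖²)³` and `ΔF = 0` identically
(`F` is harmonic). -/
theorem isoparamF_cartanMunzner :
    (∃ P : MvPolynomial (Fin 6) ℝ, P.IsHomogeneous 4 ∧
        ∀ p : EuclideanSpace ℝ (Fin 6), isoparamF p = MvPolynomial.eval p P) ∧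
      (∀ p : EuclideanSpace ℝ (Fin 6),
        ‖gradient isoparamF p‖ ^ 2 = 16 * (normSqX p + normSqY p) ^ 3) ∧
      (∀ p : EuclideanSpace ℝ (Fin 6), laplacian isoparamF p = 0) := by
 
  refine ⟨⟨isoparamPolynomial, isoparamPolynomial_isHomogeneous, congrFun isoparamF_eq_eval⟩,
    fun p => ?_, fun p => ?_⟩
  · rw [isoparamF_eq_eval, MvPolynomial.norm_gradient_eval_sq]
    simp [Fin.sum_univ_six, isoparamPolynomial, MvPolynomial.pderiv_X,
      Derivation.leibniz_pow, Pi.single_apply, normSqX, normSqY]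
    ring
  · rw [isoparamF_eq_eval, MvPolynomial.laplacian_eval]
    have htwo (i : Fin 6) : MvPolynomial.pderiv i (2 : MvPolynomial (Fin 6) ℝ) = 0 :=
      (MvPolynomial.pderiv i).map_natCast 2
    simp [htwo, Fin.sum_univ_six, isoparamPolynomial, MvPolynomial.pderiv_X,
      Derivation.leibniz_pow, Pi.single_apply]
    ring
end

section
/- Define F : ℝ⁵ → ℝ by F(x, y, X, Y, Z) = x³ − 3x·y² + (3/2)·x·(X² + Y² − 2Z²) + (3√3/2)·y·(X² − Y²) + 3√3·X·Y·Z. Then F is a homogeneous polynomial of degree 3 satisfying the Cartan–Münzner equations with g = 3 and m₁ = m₂ = 1: ‖∇F(p)‖² = 9·‖p‖⁴ for all p ∈ ℝ⁵, and ΔF = 0 identically (F is a harmonic polynomial). -/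
/-- Cartan's isoparametric cubic on `ℝ⁵`, with coordinates
`(x, y, X, Y, Z) = (p 0, p 1, p 2, p 3, p 4)`:
`F = x³ - 3xy² + (3/2)x(X² + Y² - 2Z²) + (3√3/2)y(X² - Y²) + 3√3·XYZ`. -/
noncomputable def cartanCubic (p : EuclideanSpace ℝ (Fin 5)) : ℝ :=
  p 0 ^ 3 - 3 * p 0 * p 1 ^ 2 + (3 / 2) * p 0 * (p 2 ^ 2 + p 3 ^ 2 - 2 * p 4 ^ 2) +
    (3 * Real.sqrt 3 / 2) * p 1 * (p 2 ^ 2 - p 3 ^ 2) + 3 * Real.sqrt 3 * p 2 * p 3 * p 4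

/-- The gradient of Cartan's cubic, in coordinates. -/
noncomputable def cartanGradient (p : EuclideanSpace ℝ (Fin 5)) : EuclideanSpace ℝ (Fin 5) :=
  !₂[3 * p 0 ^ 2 - 3 * p 1 ^ 2 + (3 / 2) * (p 2 ^ 2 + p 3 ^ 2 - 2 * p 4 ^ 2),
    -6 * p 0 * p 1 + (3 * √3 / 2) * (p 2 ^ 2 - p 3 ^ 2),
    3 * p 0 * p 2 + 3 * √3 * p 1 * p 2 + 3 * √3 * p 3 * p 4,
    3 * p 0 * p 3 - 3 * √3 * p 1 * p 3 + 3 * √3 * p 2 * p 4,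
    -6 * p 0 * p 4 + 3 * √3 * p 2 * p 3]

/-- The differential of `cartanGradient` at `p`, applied to `v`: the Hessian of Cartan's cubic. -/
noncomputable def cartanHessian (p v : EuclideanSpace ℝ (Fin 5)) : EuclideanSpace ℝ (Fin 5) :=
  !₂[6 * p 0 * v 0 - 6 * p 1 * v 1 + 3 * p 2 * v 2 + 3 * p 3 * v 3 - 6 * p 4 * v 4,
    -6 * p 1 * v 0 - 6 * p 0 * v 1 + 3 * √3 * p 2 * v 2 - 3 * √3 * p 3 * v 3,
    3 * p 2 * v 0 + 3 * √3 * p 2 * v 1 + (3 * p 0 + 3 * √3 * p 1) * v 2 + 3 * √3 * p 4 * v 3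
      + 3 * √3 * p 3 * v 4,
    3 * p 3 * v 0 - 3 * √3 * p 3 * v 1 + 3 * √3 * p 4 * v 2 + (3 * p 0 - 3 * √3 * p 1) * v 3
      + 3 * √3 * p 2 * v 4,
    -6 * p 4 * v 0 + 3 * √3 * p 3 * v 2 + 3 * √3 * p 2 * v 3 - 6 * p 0 * v 4]

theorem contDiff_cartanCubic : ContDiff ℝ 2 cartanCubic := by
  unfold cartanCubic
  fun_prop

theorem hasDerivAt_coord_line (p v : EuclideanSpace ℝ (Fin 5)) (i : Fin 5) :
    HasDerivAt (fun t : ℝ => (p + t • v) i) (v i) 0 := by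
  simpa using ((hasDerivAt_id (0 : ℝ)).mul_const (v i)).const_add (p i)

theorem fderiv_cartanCubic_apply (p v : EuclideanSpace ℝ (Fin 5)) :
    fderiv ℝ cartanCubic p v = inner ℝ (cartanGradient p) v := by
  rw [← (contDiff_cartanCubic.differentiable two_ne_zero p).lineDeriv_eq_fderiv]
  have h := hasDerivAt_coord_line p v
  have key := (((((h 0).pow 3).sub (((h 0).const_mul 3).mul ((h 1).pow 2))).add
    (((h 0).const_mul (3 / 2)).mul
      ((((h 2).pow 2).add ((h 3).pow 2)).sub (((h 4).pow 2).const_mul 2)))).add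
    (((h 1).const_mul (3 * √3 / 2)).mul (((h 2).pow 2).sub ((h 3).pow 2)))).add
    ((((h 2).const_mul (3 * √3)).mul (h 3)).mul (h 4))
  refine (HasDerivAt.deriv key).trans ?_
  simp [cartanGradient, PiLp.inner_apply, Fin.sum_univ_five]
  ring

theorem gradient_cartanCubic (p : EuclideanSpace ℝ (Fin 5)) :
    gradient cartanCubic p = cartanGradient p := by
  refine ext_inner_right ℝ fun v => ?_
  rw [← fderiv_cartanCubic_apply, gradient, InnerProductSpace.toDual_symm_apply]

theorem iteratedFDeriv_two_cartanCubic (p v w : EuclideanSpace ℝ (Fin 5)) :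
    iteratedFDeriv ℝ 2 cartanCubic p ![v, w] = inner ℝ (cartanHessian p v) w := by
  have hd : DifferentiableAt ℝ (fderiv ℝ cartanCubic) p :=
    (contDiff_cartanCubic.fderiv_right (m := 1) (by norm_num)).differentiable one_ne_zero p
  have hw : fderiv ℝ (fderiv ℝ cartanCubic) p v w =
      fderiv ℝ (fun q => fderiv ℝ cartanCubic q w) p v := by
    rw [fderiv_clm_apply hd (differentiableAt_const w)]
    simp
  have hdw : DifferentiableAt ℝ (fun q => fderiv ℝ cartanCubic q w) p :=
    hd.clm_apply (differentiableAt_const w)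
  rw [iteratedFDeriv_two_apply]
  simp only [Matrix.cons_val_zero, Matrix.cons_val_one]
  rw [hw, ← hdw.lineDeriv_eq_fderiv]
  simp only [fderiv_cartanCubic_apply]
  have h := hasDerivAt_coord_line p v
  have h₀ := ((((h 0).pow 2).const_mul 3).sub (((h 1).pow 2).const_mul 3)).add
    (((((h 2).pow 2).add ((h 3).pow 2)).sub (((h 4).pow 2).const_mul 2)).const_mul (3 / 2))
  have h₁ := (((h 0).const_mul (-6)).mul (h 1)).add
    ((((h 2).pow 2).sub ((h 3).pow 2)).const_mul (3 * √3 / 2))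
  have h₂ := ((((h 0).const_mul 3).mul (h 2)).add (((h 1).const_mul (3 * √3)).mul (h 2))).add
    (((h 3).const_mul (3 * √3)).mul (h 4))
  have h₃ := ((((h 0).const_mul 3).mul (h 3)).sub (((h 1).const_mul (3 * √3)).mul (h 3))).add
    (((h 2).const_mul (3 * √3)).mul (h 4))
  have h₄ := (((h 0).const_mul (-6)).mul (h 4)).add (((h 2).const_mul (3 * √3)).mul (h 3))
  have key := ((((h₀.const_mul (w 0)).add (h₁.const_mul (w 1))).add (h₂.const_mul (w 2))).add
    (h₃.const_mul (w 3))).add (h₄.const_mul (w 4))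
  refine (HasDerivAt.deriv (key.congr_of_eventuallyEq (.of_forall fun t => ?_))).trans ?_
  · simp [cartanGradient, PiLp.inner_apply, Fin.sum_univ_five]
  · simp [cartanHessian, PiLp.inner_apply, Fin.sum_univ_five]
    ring

/-- The Laplacian may be computed in any orthonormal basis. -/
theorem laplacian_eq_sum_orthonormalBasis {E ι : Type*} [NormedAddCommGroup E]
    [InnerProductSpace ℝ E] [FiniteDimensional ℝ E] [Fintype ι] (b : OrthonormalBasis ι ℝ E)
    (f : E → ℝ) (x : E) : laplacian f x = ∑ i, iteratedFDeriv ℝ 2 f x ![b i, b i] := by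
  rw [laplacian, ← congrFun (InnerProductSpace.laplacian_eq_iteratedFDeriv_orthonormalBasis f b) x,
    InnerProductSpace.laplacian_eq_iteratedFDeriv_stdOrthonormalBasis]

theorem exists_isHomogeneous_eval_eq_cartanCubic :
    ∃ P : MvPolynomial (Fin 5) ℝ, P.IsHomogeneous 3 ∧
      ∀ p : EuclideanSpace ℝ (Fin 5), cartanCubic p = MvPolynomial.eval p P := by
  have hX (i : Fin 5) := MvPolynomial.isHomogeneous_X ℝ i
  have hC (c : ℝ) := MvPolynomial.isHomogeneous_C (Fin 5) c
  refine ⟨.X 0 ^ 3 - .C 3 * .X 0 * .X 1 ^ 2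
    + .C (3 / 2) * .X 0 * (.X 2 ^ 2 + .X 3 ^ 2 - .C 2 * .X 4 ^ 2)
    + .C (3 * √3 / 2) * .X 1 * (.X 2 ^ 2 - .X 3 ^ 2)
    + .C (3 * √3) * .X 2 * .X 3 * .X 4, ?_, fun p => ?_⟩
  · exact (((((hX 0).pow 3).sub (((hC 3).mul (hX 0)).mul ((hX 1).pow 2))).add
      (((hC (3 / 2)).mul (hX 0)).mul
        ((((hX 2).pow 2).add ((hX 3).pow 2)).sub ((hC 2).mul ((hX 4).pow 2))))).add
      (((hC (3 * √3 / 2)).mul (hX 1)).mul (((hX 2).pow 2).sub ((hX 3).pow 2)))).add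
      ((((hC (3 * √3)).mul (hX 2)).mul (hX 3)).mul (hX 4))
  · simp [cartanCubic]

theorem norm_cartanGradient_sq (p : EuclideanSpace ℝ (Fin 5)) :
    ‖cartanGradient p‖ ^ 2 = 9 * ‖p‖ ^ 4 := by
  have h3 : √3 ^ 2 = (3 : ℝ) := Real.sq_sqrt (by norm_num)
  rw [show ‖p‖ ^ 4 = (‖p‖ ^ 2) ^ 2 by ring, EuclideanSpace.real_norm_sq_eq,
    EuclideanSpace.real_norm_sq_eq]
  simp only [cartanGradient, Fin.sum_univ_five, PiLp.toLp_apply, Matrix.cons_val]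
  grind

theorem laplacian_cartanCubic (p : EuclideanSpace ℝ (Fin 5)) : laplacian cartanCubic p = 0 := by
  rw [laplacian_eq_sum_orthonormalBasis (EuclideanSpace.basisFun (Fin 5) ℝ)]
  simp [iteratedFDeriv_two_cartanCubic, cartanHessian, Fin.sum_univ_five,
    EuclideanSpace.inner_single_right]
  ring

/-- Cartan's cubic
`F(x, y, X, Y, Z) = x³ - 3xy² + (3/2)x(X² + Y² - 2Z²) + (3√3/2)y(X² - Y²) + 3√3·XYZ`
on `ℝ⁵` is a homogeneous polynomial of degree `3` satisfying the Cartan–Münzner equations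
with `g = 3` and `m₁ = m₂ = 1`: `‖∇F(p)‖² = 9‖p‖⁴` for all `p ∈ ℝ⁵` and `ΔF = 0`
identically (`F` is harmonic). -/
theorem cartanCubic_cartanMunzner :
    (∃ P : MvPolynomial (Fin 5) ℝ, P.IsHomogeneous 3 ∧
        ∀ p : EuclideanSpace ℝ (Fin 5), cartanCubic p = MvPolynomial.eval p P) ∧
      (∀ p : EuclideanSpace ℝ (Fin 5), ‖gradient cartanCubic p‖ ^ 2 = 9 * ‖p‖ ^ 4) ∧
      (∀ p : EuclideanSpace ℝ (Fin 5), laplacian cartanCubic p = 0) := by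
  exact ⟨exists_isHomogeneous_eval_eq_cartanCubic,
    fun p => by rw [gradient_cartanCubic, norm_cartanGradient_sq], laplacian_cartanCubic⟩
end
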